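/- Let N ≥ 2, let Φ : ℝ → [0,∞) be a C¹ N-function, and fix constants M, M', ε, δ > 0. Then there exists C₃ > 0 such that for every locally integrable function u : ℝ^N → ℝ with a weak gradient g satisfying ∫_{ℝ^N} Φ(‖g‖) dx ≤ M, ∫_{ℝ^N} Φ(|u|) dx ≤ M', and mes({x : |u(x)| > ε}) ≥ δ, there exists z ∈ ℤ^N with ∫_{K̃(z)} Φ(|u|) dx ≥ C₃, where K̃(z) = ∏_{i=1}^N (z_i − 3/2, z_i + 3/2) is the open cube of side 3 centered at z and mes denotes Lebesgue measure. -/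

import Mathlib

open MeasureTheory Filter Topology ENNReal

noncomputable section

/-- An N-function: continuous, convex, even, nonnegative, vanishing only at `0`, with
`Φ(t)/t → 0` as `t → 0` and `Φ(t)/t → ∞` as `t → ∞`. -/
def IsNFunction (Φ : ℝ → ℝ) : Prop :=
  Continuous Φ ∧ ConvexOn ℝ Set.univ Φ ∧ (∀ t, 0 ≤ Φ t) ∧
  (∀ t, Φ t = 0 ↔ t = 0) ∧ (∀ t, Φ (-t) = Φ t) ∧
  Tendsto (fun t => Φ t / t) (𝓝[≠] (0 : ℝ)) (𝓝 0) ∧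
  Tendsto (fun t => Φ t / t) atTop atTop

/-- A locally integrable function `u : ℝ^N → ℝ` has weak gradient `g : ℝ^N → ℝ^N`. -/
def HasWeakGradient {N : ℕ} (u : EuclideanSpace ℝ (Fin N) → ℝ)
    (g : EuclideanSpace ℝ (Fin N) → EuclideanSpace ℝ (Fin N)) : Prop :=
  LocallyIntegrable u volume ∧ LocallyIntegrable g volume ∧
  ∀ φ : EuclideanSpace ℝ (Fin N) → ℝ, ContDiff ℝ (⊤ : ℕ∞) φ → HasCompactSupport φ →
    ∀ i : Fin N,
      (∫ x, u x * fderiv ℝ φ x (EuclideanSpace.single i 1)) =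
        - ∫ x, g x i * φ x

/-- `K̃(z) = ∏ᵢ (zᵢ - 3/2, zᵢ + 3/2)`, the open cube of side `3` centered at `z ∈ ℤ^N`. -/
def bigCube {N : ℕ} (z : Fin N → ℤ) : Set (EuclideanSpace ℝ (Fin N)) :=
  {x | ∀ i, x i ∈ Set.Ioo ((z i : ℝ) - 3/2) ((z i : ℝ) + 3/2)}

section Auxiliary

open scoped Convolution

variable {N : ℕ} {u : EuclideanSpace ℝ (Fin N) → ℝ}
  {g : EuclideanSpace ℝ (Fin N) → EuclideanSpace ℝ (Fin N)}

theorem HasWeakGradient.congr {u' : EuclideanSpace ℝ (Fin N) → ℝ}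
    {g' : EuclideanSpace ℝ (Fin N) → EuclideanSpace ℝ (Fin N)} (h : HasWeakGradient u g)
    (hu : u =ᵐ[volume] u') (hg : g =ᵐ[volume] g') : HasWeakGradient u' g' := by
  refine ⟨h.1.congr hu, h.2.1.congr hg, fun φ hφ hφc i => ?_⟩
  have e1 : (fun x => u x * fderiv ℝ φ x (EuclideanSpace.single i 1)) =ᵐ[volume]
      fun x => u' x * fderiv ℝ φ x (EuclideanSpace.single i 1) := by
    filter_upwards [hu] with x hx
    rw [hx]
  have e2 : (fun x => g x i * φ x) =ᵐ[volume] fun x => g' x i * φ x := by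
    filter_upwards [hg] with x hx
    rw [hx]
  rw [← integral_congr_ae e1, ← integral_congr_ae e2]
  exact h.2.2 φ hφ hφc i

/-- The weak gradient tests every directional derivative. -/
theorem HasWeakGradient.integral_mul_fderiv (h : HasWeakGradient u g)
    {φ : EuclideanSpace ℝ (Fin N) → ℝ} (hφ : ContDiff ℝ (⊤ : ℕ∞) φ) (hφc : HasCompactSupport φ)
    (v : EuclideanSpace ℝ (Fin N)) :
    ∫ x, u x * fderiv ℝ φ x v = -∫ x, inner ℝ (g x) v * φ x := by
  have hv : v = ∑ i, v i • EuclideanSpace.single i (1 : ℝ) := by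
    ext j
    simp [Pi.single_apply]
  have hder (i : Fin N) :
      Integrable (fun x => u x * fderiv ℝ φ x (EuclideanSpace.single i 1)) := by
    have hc : Continuous fun x => fderiv ℝ φ x (EuclideanSpace.single i 1) :=
      (hφ.continuous_fderiv (by simp)).clm_apply continuous_const
    have := h.1.integrable_smul_left_of_hasCompactSupport hc
      (hφc.fderiv_apply ℝ (EuclideanSpace.single i 1))
    simpa [mul_comm] using this
  have hgi (i : Fin N) : Integrable (fun x => g x i * φ x) := by
    have h1 := h.2.1.integrable_smul_left_of_hasCompactSupport hφ.continuous hφc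
    have := (EuclideanSpace.proj (𝕜 := ℝ) i).integrable_comp h1
    simpa [mul_comm] using this
  have e1 (x) : u x * fderiv ℝ φ x v =
      ∑ i, v i * (u x * fderiv ℝ φ x (EuclideanSpace.single i 1)) := by
    conv_lhs => rw [hv, map_sum, Finset.mul_sum]
    refine Finset.sum_congr rfl fun i _ => ?_
    rw [map_smul, smul_eq_mul]
    ring
  have e2 (x) : inner ℝ (g x) v * φ x = ∑ i, v i * (g x i * φ x) := by
    rw [PiLp.inner_apply, Finset.sum_mul]
    refine Finset.sum_congr rfl fun i _ => ?_
    simp only [RCLike.inner_apply, conj_trivial]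
    ring
  simp_rw [e1, e2]
  rw [integral_finsetSum _ fun i _ => (hder i).const_mul _,
    integral_finsetSum _ fun i _ => (hgi i).const_mul _, ← Finset.sum_neg_distrib]
  refine Finset.sum_congr rfl fun i _ => ?_
  rw [integral_const_mul, integral_const_mul, h.2.2 φ hφ hφc i, mul_neg]

/-- Mollification commutes with the weak gradient. -/
theorem HasWeakGradient.fderiv_convolution_apply (h : HasWeakGradient u g)
    {η : EuclideanSpace ℝ (Fin N) → ℝ} (hη : ContDiff ℝ (⊤ : ℕ∞) η) (hηc : HasCompactSupport η)
    (x v : EuclideanSpace ℝ (Fin N)) :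
    fderiv ℝ (η ⋆[ContinuousLinearMap.lsmul ℝ ℝ, volume] u) x v =
      ∫ t, inner ℝ (g t) v * η (x - t) := by
  have hη1 : ContDiff ℝ 1 η := hη.of_le (by simp)
  have hex := (hηc.fderiv ℝ).convolutionExists_left
    ((ContinuousLinearMap.lsmul ℝ ℝ : ℝ →L[ℝ] ℝ →L[ℝ] ℝ).precompL (EuclideanSpace ℝ (Fin N)))
    (hη.continuous_fderiv (by simp)) h.1 x
  rw [ConvolutionExistsAt] at hex
  rw [(hηc.hasFDerivAt_convolution_left (ContinuousLinearMap.lsmul ℝ ℝ) hη1 h.1 x).fderiv,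
    convolution_def, ContinuousLinearMap.integral_apply hex]
  simp only [ContinuousLinearMap.precompL_apply, ContinuousLinearMap.lsmul_apply, smul_eq_mul]
  rw [← integral_sub_left_eq_self _ _ x]
  have hφ : ContDiff ℝ (⊤ : ℕ∞) fun t => η (x - t) := hη.comp (contDiff_const.sub contDiff_id)
  have hφc : HasCompactSupport fun t => η (x - t) :=
    hηc.comp_homeomorph (Homeomorph.subLeft x)
  have key := h.integral_mul_fderiv hφ hφc v
  rw [← neg_eq_iff_eq_neg] at key
  rw [← key, ← integral_neg]
  refine integral_congr_ae (.of_forall fun t => ?_)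
  have hd : HasFDerivAt (fun t => η (x - t))
      ((fderiv ℝ η (x - t)).comp (-ContinuousLinearMap.id ℝ _)) t :=
    HasFDerivAt.comp t ((hη.differentiable (by simp)) (x - t)).hasFDerivAt
      ((hasFDerivAt_id t).const_sub x)
  simp only [hd.fderiv]
  simp [mul_comm]

theorem enorm_add_sub_le_lintegral_fderiv {E : Type*} [NormedAddCommGroup E] [NormedSpace ℝ E]
    {f : E → ℝ} (hf : ContDiff ℝ 1 f) (x v : E) :
    ‖f (x + v) - f x‖ₑ ≤ ∫⁻ s in Set.Ioc (0 : ℝ) 1, ‖fderiv ℝ f (x + s • v) v‖ₑ := by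
  have hline (s : ℝ) : HasDerivAt (fun s : ℝ => x + s • v) v s := by
    simpa using ((hasDerivAt_id s).smul_const v).const_add x
  have hd (s : ℝ) : HasDerivAt (fun s : ℝ => f (x + s • v)) (fderiv ℝ f (x + s • v) v) s :=
    ((hf.differentiable (by simp)) (x + s • v)).hasFDerivAt.comp_hasDerivAt s (hline s)
  have hc : Continuous fun s : ℝ => fderiv ℝ f (x + s • v) v :=
    ((hf.continuous_fderiv (by simp)).comp (by fun_prop)).clm_apply continuous_const
  have := intervalIntegral.integral_eq_sub_of_hasDerivAt (a := 0) (b := 1)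
    (fun s _ => hd s) (hc.intervalIntegrable 0 1)
  simp only [one_smul, zero_smul, add_zero] at this
  rw [← this, intervalIntegral.integral_of_le zero_le_one]
  exact enorm_integral_le_lintegral_enorm _

/-- Translation estimate on a set for a mollified function. -/
theorem HasWeakGradient.setLIntegral_convolution_add_sub_le (h : HasWeakGradient u g)
    {η : EuclideanSpace ℝ (Fin N) → ℝ} (hη : ContDiff ℝ (⊤ : ℕ∞) η) (hηc : HasCompactSupport η)
    (hη1 : ∫⁻ x, ‖η x‖ₑ = 1) {Ψ : EuclideanSpace ℝ (Fin N) → ℝ≥0∞} (hΨ : Measurable Ψ)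
    {A : ℝ≥0∞} (hA : ∀ x, ‖g x‖ₑ ≤ Ψ x + A) (E : Set (EuclideanSpace ℝ (Fin N)))
    (v : EuclideanSpace ℝ (Fin N)) :
    ∫⁻ x in E, ‖(η ⋆[ContinuousLinearMap.lsmul ℝ ℝ, volume] u) (x + v) -
        (η ⋆[ContinuousLinearMap.lsmul ℝ ℝ, volume] u) x‖ₑ ≤
      ‖v‖ₑ * ((∫⁻ x, Ψ x) + A * volume E) := by
  set W := η ⋆[ContinuousLinearMap.lsmul ℝ ℝ, volume] u with hW
  have hWd : ContDiff ℝ 1 W :=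
    hηc.contDiff_convolution_left _ (hη.of_le (by simp)) h.1
  have hηm : Measurable fun x => ‖η x‖ₑ := hη.continuous.measurable.enorm
  set G : EuclideanSpace ℝ (Fin N) → ℝ≥0∞ := fun y => ∫⁻ t, Ψ t * ‖η (y - t)‖ₑ with hG
  have hGm2 : Measurable fun p : EuclideanSpace ℝ (Fin N) × EuclideanSpace ℝ (Fin N) =>
      Ψ p.2 * ‖η (p.1 - p.2)‖ₑ :=
    (hΨ.comp measurable_snd).mul (hηm.comp (measurable_fst.sub measurable_snd))
  have hGm : Measurable G := hGm2.lintegral_prod_right'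
  have hGint : ∫⁻ y, G y = ∫⁻ t, Ψ t := by
    rw [hG, lintegral_lintegral_swap hGm2.aemeasurable]
    refine lintegral_congr fun t => ?_
    have hηt : Measurable fun y => ‖η (y - t)‖ₑ := hηm.comp (measurable_id.sub_const t)
    rw [lintegral_const_mul _ hηt,
      lintegral_sub_right_eq_self (fun y => ‖η y‖ₑ) t, hη1, mul_one]
  have hder (y : EuclideanSpace ℝ (Fin N)) : ‖fderiv ℝ W y v‖ₑ ≤ ‖v‖ₑ * (G y + A) := by
    rw [hW, h.fderiv_convolution_apply hη hηc]
    refine (enorm_integral_le_lintegral_enorm _).trans ?_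
    have hηy : Measurable fun t => ‖η (y - t)‖ₑ := hηm.comp (measurable_id.const_sub y)
    have hsum : Measurable fun t => Ψ t * ‖η (y - t)‖ₑ + A * ‖η (y - t)‖ₑ :=
      (hΨ.mul hηy).add (hηy.const_mul A)
    calc ∫⁻ t, ‖inner ℝ (g t) v * η (y - t)‖ₑ
        ≤ ∫⁻ t, ‖v‖ₑ * (Ψ t * ‖η (y - t)‖ₑ + A * ‖η (y - t)‖ₑ) := by
          refine lintegral_mono fun t => ?_
          rw [enorm_mul, ← add_mul, ← mul_assoc]
          gcongr
          calc ‖inner ℝ (g t) v‖ₑ ≤ ‖g t‖ₑ * ‖v‖ₑ := by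
                simp only [enorm_eq_nnnorm]
                exact_mod_cast nnnorm_inner_le_nnnorm (𝕜 := ℝ) (g t) v
            _ ≤ ‖v‖ₑ * (Ψ t + A) := by rw [mul_comm]; gcongr; exact hA t
      _ = ‖v‖ₑ * (G y + A) := by
          rw [lintegral_const_mul _ hsum,
            lintegral_add_right _ (hηy.const_mul A), lintegral_const_mul _ hηy,
            lintegral_sub_left_eq_self (fun t => ‖η t‖ₑ) y, hη1, mul_one]
  have hjoint : Measurable fun p : EuclideanSpace ℝ (Fin N) × ℝ =>
      ‖v‖ₑ * (G (p.1 + p.2 • v) + A) :=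
    ((hGm.comp (by fun_prop)).add_const A).const_mul _
  calc ∫⁻ x in E, ‖W (x + v) - W x‖ₑ
      ≤ ∫⁻ x in E, ∫⁻ s in Set.Ioc (0 : ℝ) 1, ‖v‖ₑ * (G (x + s • v) + A) :=
        lintegral_mono fun x => (enorm_add_sub_le_lintegral_fderiv hWd x v).trans
          (lintegral_mono fun s => hder _)
    _ = ∫⁻ s in Set.Ioc (0 : ℝ) 1, ∫⁻ x in E, ‖v‖ₑ * (G (x + s • v) + A) :=
        lintegral_lintegral_swap hjoint.aemeasurable
    _ ≤ ∫⁻ _ in Set.Ioc (0 : ℝ) 1, ‖v‖ₑ * ((∫⁻ x, Ψ x) + A * volume E) := by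
        refine lintegral_mono fun s => ?_
        have hGs : Measurable fun x => G (x + s • v) := hGm.comp (measurable_id.add_const _)
        simp only
        rw [lintegral_const_mul _ (hGs.add_const A), lintegral_add_left hGs,
          setLIntegral_const]
        have hle : ∫⁻ x in E, G (x + s • v) ≤ ∫⁻ x, Ψ x := by
          refine (setLIntegral_le_lintegral _ _).trans ?_
          rw [lintegral_add_right_eq_self G (s • v), hGint]
        gcongr
    _ = ‖v‖ₑ * ((∫⁻ x, Ψ x) + A * volume E) := by simp

/-- Translation estimate on a set for a function with a weak gradient. -/
theorem HasWeakGradient.setLIntegral_add_sub_le (h : HasWeakGradient u g)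
    {Ψ : EuclideanSpace ℝ (Fin N) → ℝ≥0∞} (hΨ : Measurable Ψ)
    {A : ℝ≥0∞} (hA : ∀ x, ‖g x‖ₑ ≤ Ψ x + A) (E : Set (EuclideanSpace ℝ (Fin N)))
    (v : EuclideanSpace ℝ (Fin N)) :
    ∫⁻ x in E, ‖u (x + v) - u x‖ₑ ≤ ‖v‖ₑ * ((∫⁻ x, Ψ x) + A * volume E) := by
  let φ : ℕ → ContDiffBump (0 : EuclideanSpace ℝ (Fin N)) := fun n =>
    { rIn := 1 / ((n : ℝ) + 1)
      rOut := 2 * (1 / ((n : ℝ) + 1))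
      rIn_pos := Nat.one_div_pos_of_nat
      rIn_lt_rOut := by
        have : 0 < 1 / ((n : ℝ) + 1) := Nat.one_div_pos_of_nat
        linarith }
  let W : ℕ → EuclideanSpace ℝ (Fin N) → ℝ := fun n =>
    (φ n).normed volume ⋆[ContinuousLinearMap.lsmul ℝ ℝ, volume] u
  have hlim : ∀ᵐ x, Tendsto (fun n => W n x) atTop (𝓝 (u x)) := by
    refine ContDiffBump.ae_convolution_tendsto_right_of_locallyIntegrable (K := 2) ?_ ?_ h.1
    · simpa [φ] using (tendsto_one_div_add_atTop_nhds_zero_nat (𝕜 := ℝ)).const_mul 2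
    · exact .of_forall fun n => le_rfl
  have hlim' : ∀ᵐ x, Tendsto (fun n => W n (x + v)) atTop (𝓝 (u (x + v))) :=
    (measurePreserving_add_right volume v).quasiMeasurePreserving.ae hlim
  have hη1 (n : ℕ) : ∫⁻ x, ‖(φ n).normed volume x‖ₑ = 1 := by
    have := (φ n).integral_normed (μ := volume)
    rw [integral_eq_lintegral_of_nonneg_ae (.of_forall (φ n).nonneg_normed)
      (φ n).continuous_normed.aestronglyMeasurable] at this
    rw [ENNReal.toReal_eq_one_iff] at this
    rw [← this]
    exact lintegral_congr fun x => Real.enorm_of_nonneg ((φ n).nonneg_normed x)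
  have hWc (n : ℕ) : Continuous (W n) :=
    ((φ n).hasCompactSupport_normed.contDiff_convolution_left (n := 1) _
      (φ n).contDiff_normed h.1).continuous
  calc ∫⁻ x in E, ‖u (x + v) - u x‖ₑ
      = ∫⁻ x in E, liminf (fun n => ‖W n (x + v) - W n x‖ₑ) atTop := by
        refine lintegral_congr_ae (ae_restrict_of_ae ?_)
        filter_upwards [hlim, hlim'] with x h1 h2
        exact ((h2.sub h1).enorm).liminf_eq.symm
    _ ≤ liminf (fun n => ∫⁻ x in E, ‖W n (x + v) - W n x‖ₑ) atTop :=
        lintegral_liminf_le fun n => by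
          have := hWc n
          exact Continuous.measurable (by fun_prop)
    _ ≤ ‖v‖ₑ * ((∫⁻ x, Ψ x) + A * volume E) := by
        refine liminf_le_of_le (by isBoundedDefault) fun b hb => ?_
        obtain ⟨n, hn⟩ := hb.exists
        exact hn.trans (h.setLIntegral_convolution_add_sub_le (φ n).contDiff_normed
          (φ n).hasCompactSupport_normed (hη1 n) hΨ hA E v)

/-- Averaging over translations in a ball the part of `E` that is sent into `S`. -/
theorem lintegral_ball_measure_inter_preimage_add {E S : Set (EuclideanSpace ℝ (Fin N))}
    (hS : MeasurableSet S) (r : ℝ) :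
    ∫⁻ v in Metric.ball 0 r, volume (E ∩ {x | x + v ∈ S}) =
      ∫⁻ x in E, volume (S ∩ Metric.ball x r) := by
  have hm : Measurable fun p : EuclideanSpace ℝ (Fin N) × EuclideanSpace ℝ (Fin N) =>
      S.indicator (1 : EuclideanSpace ℝ (Fin N) → ℝ≥0∞) (p.2 + p.1) :=
    (measurable_one.indicator hS).comp (measurable_snd.add measurable_fst)
  have h1 (v : EuclideanSpace ℝ (Fin N)) : volume (E ∩ {x | x + v ∈ S}) =
      ∫⁻ x in E, S.indicator (1 : EuclideanSpace ℝ (Fin N) → ℝ≥0∞) (x + v) := by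
    have hSv : MeasurableSet {x | x + v ∈ S} := measurable_add_const v hS
    rw [Set.inter_comm, ← Measure.restrict_apply hSv, ← lintegral_indicator_one hSv]
    rfl
  have h2 (x : EuclideanSpace ℝ (Fin N)) : volume (S ∩ Metric.ball x r) =
      ∫⁻ v in Metric.ball 0 r, S.indicator (1 : EuclideanSpace ℝ (Fin N) → ℝ≥0∞) (x + v) := by
    have hSx : MeasurableSet ((x + ·) ⁻¹' S) := measurable_const_add x hS
    rw [← measure_preimage_add volume x, Set.preimage_inter, preimage_add_ball, sub_self,
      ← Measure.restrict_apply hSx, ← lintegral_indicator_one hSx]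
    rfl
  simp_rw [h1, h2]
  exact lintegral_lintegral_swap hm.aemeasurable

/-- Chebyshev's inequality on a set where `f` is bounded below. -/
theorem ofReal_mul_measure_le_setLIntegral {α : Type*} [MeasurableSpace α] {μ : Measure α}
    {f : α → ℝ≥0∞} {s t : Set α} {c : ℝ≥0∞} (hs : MeasurableSet s) (hst : s ⊆ t)
    (hc : ∀ x ∈ s, c ≤ f x) : c * μ s ≤ ∫⁻ x in t, f x ∂μ :=
  calc c * μ s = ∫⁻ _ in s, c ∂μ := (setLIntegral_const s c).symm
    _ ≤ ∫⁻ x in s, f x ∂μ := setLIntegral_mono' hs hc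
    _ ≤ ∫⁻ x in t, f x ∂μ := lintegral_mono_set hst

theorem ball_subset_bigCube_round (x : EuclideanSpace ℝ (Fin N)) {r : ℝ} (hr : r ≤ 1) :
    Metric.ball x r ⊆ bigCube fun i => round (x i) := by
  intro y hy i
  have h1 : |y i - x i| < 1 := by
    have : ‖(y - x) i‖ ≤ ‖y - x‖ := PiLp.norm_apply_le _ i
    rw [Metric.mem_ball, dist_eq_norm] at hy
    simpa using this.trans_lt (hy.trans_le hr)
  have h2 := abs_le.1 (abs_sub_round (x i))
  rw [abs_lt] at h1
  constructor <;> linarith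

theorem IsNFunction.pos {Φ : ℝ → ℝ} (hΦ : IsNFunction Φ) {t : ℝ} (ht : 0 < t) : 0 < Φ t :=
  (hΦ.2.2.1 t).lt_of_ne fun h => ht.ne' ((hΦ.2.2.2.1 t).1 h.symm)

theorem IsNFunction.mono {Φ : ℝ → ℝ} (hΦ : IsNFunction Φ) {s t : ℝ} (hs : 0 < s) (hst : s ≤ t) :
    Φ s ≤ Φ t := by
  obtain ⟨-, hconv, hnn, hz, -⟩ := hΦ
  have ht : 0 < t := hs.trans_le hst
  have hle : s / t ≤ 1 := (div_le_one ht).2 hst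
  have := hconv.2 (Set.mem_univ t) (Set.mem_univ 0) (div_nonneg hs.le ht.le)
    (sub_nonneg.2 hle) (by ring)
  simp only [smul_eq_mul, mul_zero, add_zero, (hz 0).2 rfl] at this
  rw [div_mul_cancel₀ _ ht.ne'] at this
  exact this.trans (mul_le_of_le_one_left (hnn t) hle)

theorem IsNFunction.exists_le_add {Φ : ℝ → ℝ} (hΦ : IsNFunction Φ) :
    ∃ A : ℝ, 0 < A ∧ ∀ t, t ≤ Φ t + A := by
  obtain ⟨T, hT⟩ := eventually_atTop.1 (hΦ.2.2.2.2.2.2.eventually_ge_atTop 1)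
  refine ⟨max T 1, lt_max_of_lt_right one_pos, fun t => ?_⟩
  rcases le_total t (max T 1) with h | h
  · linarith [hΦ.2.2.1 t]
  · have h1 : 0 < t := one_pos.trans_le ((le_max_right _ _).trans h)
    have := (one_le_div h1).1 (hT t ((le_max_left _ _).trans h))
    linarith [le_max_right T 1]

/-- If a set of positive measure lies in `[|u| > 2a]` and the translates of `u` are close to `u`
in mean on it, then `[|u| > a]` has density at least one half in some small ball. -/
theorem exists_half_measure_ball_lt {E : Set (EuclideanSpace ℝ (Fin N))} (hu : Measurable u)
    {a r B : ℝ} (ha : 0 < a) (hr : 0 < r) (hB : 0 ≤ B) (hE : MeasurableSet E)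
    (hEu : ∀ x ∈ E, 2 * a < |u x|) (hEfin : volume E ≠ ∞)
    (hrB : ENNReal.ofReal (2 * r * B / a) < volume E)
    (htrans : ∀ v, ∫⁻ x in E, ‖u (x + v) - u x‖ₑ ≤ ‖v‖ₑ * ENNReal.ofReal B) :
    ∃ x, volume (Metric.ball (0 : EuclideanSpace ℝ (Fin N)) r) / 2 <
      volume ({y | a < |u y|} ∩ Metric.ball x r) := by
  by_contra! hcon
  set S := {y | a < |u y|}
  have hS : MeasurableSet S := measurableSet_lt measurable_const hu.abs
  set w := volume (Metric.ball (0 : EuclideanSpace ℝ (Fin N)) r)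
  have hw0 : w ≠ 0 := (Metric.measure_ball_pos _ _ hr).ne'
  have hwt : w ≠ ∞ := measure_ball_lt_top.ne
  have hstep (v) (hv : v ∈ Metric.ball (0 : EuclideanSpace ℝ (Fin N)) r) :
      volume E ≤ volume (E ∩ {x | x + v ∈ S}) + ENNReal.ofReal (r * B / a) := by
    have hSv : MeasurableSet {x | x + v ∈ S} := measurable_add_const v hS
    rw [← measure_inter_add_sdiff E hSv]
    gcongr
    have hcheb : ENNReal.ofReal a * volume (E \ {x | x + v ∈ S}) ≤
        ∫⁻ x in E, ‖u (x + v) - u x‖ₑ := by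
      refine ofReal_mul_measure_le_setLIntegral (hE.diff hSv) Set.sdiff_subset fun x hx => ?_
      have h1 := hEu x hx.1
      have h2 : |u (x + v)| ≤ a := not_lt.1 hx.2
      rw [Real.enorm_eq_ofReal_abs]
      refine ENNReal.ofReal_le_ofReal ?_
      have := abs_sub_abs_le_abs_sub (u x) (u (x + v))
      rw [abs_sub_comm] at this
      linarith
    have hvr : ‖v‖ₑ ≤ ENNReal.ofReal r := by
      rw [← ofReal_norm]
      exact ENNReal.ofReal_le_ofReal (mem_ball_zero_iff.1 hv).le
    rw [ENNReal.ofReal_div_of_pos ha, ENNReal.ofReal_mul hr.le, ENNReal.le_div_iff_mul_le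
      (.inl (ENNReal.ofReal_pos.2 ha).ne') (.inl ENNReal.ofReal_ne_top), mul_comm]
    exact (hcheb.trans (htrans v)).trans (by gcongr)
  have havg : volume E * w ≤ w / 2 * volume E + ENNReal.ofReal (r * B / a) * w :=
    calc volume E * w = ∫⁻ _ in Metric.ball (0 : EuclideanSpace ℝ (Fin N)) r, volume E := by
          rw [setLIntegral_const]
      _ ≤ ∫⁻ v in Metric.ball (0 : EuclideanSpace ℝ (Fin N)) r,
            (volume (E ∩ {x | x + v ∈ S}) + ENNReal.ofReal (r * B / a)) :=
          setLIntegral_mono' measurableSet_ball hstep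
      _ = (∫⁻ x in E, volume (S ∩ Metric.ball x r)) + ENNReal.ofReal (r * B / a) * w := by
          rw [lintegral_add_right _ measurable_const, setLIntegral_const,
            lintegral_ball_measure_inter_preimage_add hS]
      _ ≤ w / 2 * volume E + ENNReal.ofReal (r * B / a) * w := by
          gcongr
          rw [← setLIntegral_const]
          exact lintegral_mono fun x => hcon x
  lift w to NNReal using hwt with w'
  lift volume E to NNReal using hEfin with e
  have hw0' : 0 < (w' : ℝ) := by
    have : w' ≠ 0 := by exact_mod_cast hw0
    positivity
  have hpos : 0 ≤ r * B / a := by positivity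
  have hreal : (e : ℝ) * w' ≤ w' / 2 * e + r * B / a * w' := by
    have := ENNReal.toReal_mono (by finiteness) havg
    rw [ENNReal.toReal_add (by finiteness) (by finiteness)] at this
    simpa [ENNReal.toReal_mul, ENNReal.toReal_ofReal hpos] using this
  have hlt : 2 * r * B / a < e := by
    rw [ENNReal.ofReal_lt_iff_lt_toReal (by positivity) (by finiteness)] at hrB
    simpa using hrB
  have : (e : ℝ) ≤ 2 * (r * B / a) := by
    refine le_of_mul_le_mul_right ?_ hw0'
    linarith
  have e1 : 2 * r * B / a = 2 * (r * B / a) := by ring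
  linarith

end Auxiliary

/-- The quantitative core of the Lieb-type theorem: for fixed `N ≥ 2`, a C¹ N-function
`Φ` and constants `M, M', ε, δ > 0`, there is `C₃ > 0` such that any `u` with a weak
gradient `g`, `∫ Φ(‖g‖) ≤ M`, `∫ Φ(|u|) ≤ M'` and `mes([|u| > ε]) ≥ δ` admits `z ∈ ℤ^N`
with `∫_{K̃(z)} Φ(|u|) ≥ C₃`. -/
theorem lieb_quantitative (N : ℕ) (hN : 2 ≤ N) (Φ : ℝ → ℝ)
    (hΦ : IsNFunction Φ) (hΦC1 : ContDiff ℝ 1 Φ)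
    (M M' ε δ : ℝ) (hM : 0 < M) (hM' : 0 < M') (hε : 0 < ε) (hδ : 0 < δ) :
    ∃ C₃ : ℝ, 0 < C₃ ∧
      ∀ (u : EuclideanSpace ℝ (Fin N) → ℝ)
        (g : EuclideanSpace ℝ (Fin N) → EuclideanSpace ℝ (Fin N)),
        HasWeakGradient u g →
        (∫⁻ x, ENNReal.ofReal (Φ ‖g x‖)) ≤ ENNReal.ofReal M →
        (∫⁻ x, ENNReal.ofReal (Φ |u x|)) ≤ ENNReal.ofReal M' →
        ENNReal.ofReal δ ≤ volume {x | ε < |u x|} →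
        ∃ z : Fin N → ℤ,
          ENNReal.ofReal C₃ ≤ ∫⁻ x in bigCube z, ENNReal.ofReal (Φ |u x|) := by
  obtain ⟨A, hA0, hA⟩ := hΦ.exists_le_add
  have hΦm : Measurable Φ := hΦ.1.measurable
  have hε2 : 0 < ε / 2 := half_pos hε
  have hΦε := hΦ.pos hε
  have hΦε2 := hΦ.pos hε2
  set B : ℝ := M + A * (M' / Φ ε) with hBdef
  have hB : 0 < B := by positivity
  set r : ℝ := min 1 (ε * δ / (8 * B))
  have hr : 0 < r := lt_min one_pos (by positivity)
  set w := volume (Metric.ball (0 : EuclideanSpace ℝ (Fin N)) r)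
  have hwt : w ≠ ∞ := measure_ball_lt_top.ne
  have hw0 : 0 < w.toReal := ENNReal.toReal_pos (Metric.measure_ball_pos _ _ hr).ne' hwt
  refine ⟨Φ (ε / 2) * (w.toReal / 2), by positivity, fun u₀ g₀ h₀ hg₀ hu₀ hδ₀ => ?_⟩
  obtain ⟨u, hum, hu⟩ := h₀.1.aestronglyMeasurable.aemeasurable
  obtain ⟨g, hgm, hg⟩ := h₀.2.1.aestronglyMeasurable.aemeasurable
  have h : HasWeakGradient u g := h₀.congr hu hg
  have hug : ∀ᵐ x, ENNReal.ofReal (Φ |u₀ x|) = ENNReal.ofReal (Φ |u x|) := by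
    filter_upwards [hu] with x hx
    rw [hx]
  have hgg : ∀ᵐ x, ENNReal.ofReal (Φ ‖g₀ x‖) = ENNReal.ofReal (Φ ‖g x‖) := by
    filter_upwards [hg] with x hx
    rw [hx]
  rw [lintegral_congr_ae hgg] at hg₀
  rw [lintegral_congr_ae hug] at hu₀
  set E := {x | ε < |u x|} with hEdef
  have hE : MeasurableSet E := measurableSet_lt measurable_const hum.abs
  have hδE : ENNReal.ofReal δ ≤ volume E := by
    refine hδ₀.trans_eq (measure_congr ?_)
    filter_upwards [hu] with x hx
    change (ε < |u₀ x|) = (ε < |u x|)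
    rw [hx]
  have hEle : volume E ≤ ENNReal.ofReal (M' / Φ ε) := by
    rw [ENNReal.ofReal_div_of_pos hΦε, ENNReal.le_div_iff_mul_le
      (.inl (ENNReal.ofReal_pos.2 hΦε).ne') (.inl ENNReal.ofReal_ne_top), mul_comm]
    refine le_trans ?_ hu₀
    rw [← setLIntegral_univ]
    exact ofReal_mul_measure_le_setLIntegral hE (Set.subset_univ _) fun x hx =>
      ENNReal.ofReal_le_ofReal (hΦ.mono hε (le_of_lt hx))
  have htrans (v) : ∫⁻ x in E, ‖u (x + v) - u x‖ₑ ≤ ‖v‖ₑ * ENNReal.ofReal B := by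
    refine (h.setLIntegral_add_sub_le (A := ENNReal.ofReal A)
      (hΦm.comp hgm.norm).ennreal_ofReal (fun x => ?_) E v).trans ?_
    · rw [← ofReal_norm, Function.comp_apply, ← ENNReal.ofReal_add (hΦ.2.2.1 _) hA0.le]
      exact ENNReal.ofReal_le_ofReal (hA _)
    · rw [hBdef, ENNReal.ofReal_add hM.le (by positivity), ENNReal.ofReal_mul hA0.le]
      gcongr
      exact hg₀
  have hrB : ENNReal.ofReal (2 * r * B / (ε / 2)) < volume E := by
    refine lt_of_lt_of_le ((ENNReal.ofReal_lt_ofReal_iff hδ).2 ?_) hδE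
    have : r ≤ ε * δ / (8 * B) := min_le_right _ _
    rw [le_div_iff₀ (by positivity)] at this
    rw [div_lt_iff₀ hε2]
    nlinarith [mul_pos hε hδ]
  obtain ⟨x, hx⟩ := exists_half_measure_ball_lt hum hε2 hr hB.le hE
    (fun x hx => by rw [mul_div_cancel₀ _ two_ne_zero]; exact hx)
    (hEle.trans_lt ENNReal.ofReal_lt_top).ne hrB htrans
  refine ⟨fun i => round (x i), ?_⟩
  rw [lintegral_congr_ae (ae_restrict_of_ae hug), ENNReal.ofReal_mul hΦε2.le,
    ENNReal.ofReal_div_of_pos two_pos, ENNReal.ofReal_toReal hwt]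
  have hS : MeasurableSet ({y | ε / 2 < |u y|} ∩ Metric.ball x r) :=
    (measurableSet_lt measurable_const hum.abs).inter measurableSet_ball
  refine le_trans ?_ (ofReal_mul_measure_le_setLIntegral (c := ENNReal.ofReal (Φ (ε / 2))) hS
    (Set.inter_subset_right.trans (ball_subset_bigCube_round x (min_le_left _ _)))
    fun y hy => ENNReal.ofReal_le_ofReal (hΦ.mono hε2 (le_of_lt hy.1)))
  gcongr
  simpa using hx.le
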